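/- For every ε > 0 there exists a constant M > 0 (depending only on ε) such that for every continuously differentiable, compactly supported u : ℝ² → ℝ² and every twice continuously differentiable, compactly supported C : ℝ² → ℝ, |∫_{ℝ²} (u(x) · ∇C(x)) ΔC(x) dx| ≤ ε ‖ΔC‖_{L²}² + M ‖∇C‖_{L²}² ‖u‖_{L²}² ‖∇u‖_{L²}². -/

import Mathlib

open MeasureTheory

/-- The `i`-th partial derivative of a scalar function on `ℝ²`. -/
noncomputable def pderiv2 (f : (Fin 2 → ℝ) → ℝ) (i : Fin 2) (x : Fin 2 → ℝ) : ℝ :=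
  fderiv ℝ f x (Pi.single i 1)

/-- The Laplacian of a scalar function on `ℝ²`. -/
noncomputable def lap2 (f : (Fin 2 → ℝ) → ℝ) (x : Fin 2 → ℝ) : ℝ :=
  ∑ j, pderiv2 (pderiv2 f j) j x

lemma supp_sq {f : (Fin 2 → ℝ) → ℝ} (hf : HasCompactSupport f) :
    HasCompactSupport (fun x => f x ^ 2) := by
  have h : HasCompactSupport (f * f) := hf.mul_right
  have e : (fun x => f x ^ 2) = f * f := by ext x; simp [sq]
  rw [e]
  exact h

lemma int_add3 {f g h : (Fin 2 → ℝ) → ℝ} (hf : Integrable f) (hg : Integrable g)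
    (hh : Integrable h) :
    ∫ x, (f x + g x + h x) = (∫ x, f x) + (∫ x, g x) + ∫ x, h x := by
  have hfg : Integrable (fun x => f x + g x) := hf.add hg
  rw [integral_add hfg hh, integral_add hf hg]

lemma pd_cont {f : (Fin 2 → ℝ) → ℝ} (hf : ContDiff ℝ 1 f) (i : Fin 2) :
    Continuous (pderiv2 f i) := by
  have := hf.continuous_fderiv one_ne_zero
  unfold pderiv2
  fun_prop

lemma pd_supp {f : (Fin 2 → ℝ) → ℝ} (hf : HasCompactSupport f) (i : Fin 2) :
    HasCompactSupport (pderiv2 f i) := hf.fderiv_apply ℝ _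

lemma pd_contDiff {f : (Fin 2 → ℝ) → ℝ} (hf : ContDiff ℝ 2 f) (i : Fin 2) :
    ContDiff ℝ 1 (pderiv2 f i) := by
  have : ContDiff ℝ 1 (fderiv ℝ f) := hf.fderiv_right (by norm_num)
  unfold pderiv2
  fun_prop

/-- The `L²` Cauchy-Schwarz inequality for continuous compactly supported functions. -/
lemma cs_int {f g : (Fin 2 → ℝ) → ℝ} (hf : Continuous f) (hf' : HasCompactSupport f)
    (hg : Continuous g) (hg' : HasCompactSupport g) :
    (∫ x, f x * g x) ^ 2 ≤ (∫ x, f x ^ 2) * (∫ x, g x ^ 2) := by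
  have i1 : Integrable (fun x => f x ^ 2) := by
    refine Continuous.integrable_of_hasCompactSupport (by fun_prop) ?_
    exact supp_sq hf'
  have i2 : Integrable (fun x => g x ^ 2) := by
    refine Continuous.integrable_of_hasCompactSupport (by fun_prop) ?_
    exact supp_sq hg'
  have i3 : Integrable (fun x => f x * g x) :=
    Continuous.integrable_of_hasCompactSupport (by fun_prop) hf'.mul_right
  have key := discrim_le_zero (a := ∫ x, f x ^ 2) (b := 2 * ∫ x, f x * g x)
    (c := ∫ x, g x ^ 2) (fun t => by
      have : (0 : ℝ) ≤ ∫ x, (t * t) * f x ^ 2 + (2 * t) * (f x * g x) + g x ^ 2 :=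
        integral_nonneg (fun x => by
          show (0 : ℝ) ≤ (t * t) * f x ^ 2 + (2 * t) * (f x * g x) + g x ^ 2
          nlinarith [sq_nonneg (t * f x + g x)])
      rw [int_add3 (i1.const_mul _) (i3.const_mul _) i2, integral_const_mul,
        integral_const_mul] at this
      linarith)
  rw [discrim] at key
  nlinarith

lemma norm_fderiv_le (f : (Fin 2 → ℝ) → ℝ) (x : Fin 2 → ℝ) :
    ‖fderiv ℝ f x‖ ≤ |pderiv2 f 0 x| + |pderiv2 f 1 x| := by
  refine ContinuousLinearMap.opNorm_le_bound _ (by positivity) (fun v => ?_)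
  have hv : v = v 0 • Pi.single 0 1 + v 1 • Pi.single 1 1 := by
    ext i; fin_cases i <;> simp
  have h0 : |v 0| ≤ ‖v‖ := norm_le_pi_norm v 0
  have h1 : |v 1| ≤ ‖v‖ := norm_le_pi_norm v 1
  have e : fderiv ℝ f x v = v 0 * pderiv2 f 0 x + v 1 * pderiv2 f 1 x := by
    conv_lhs => rw [hv]
    simp [pderiv2]
  rw [e, Real.norm_eq_abs]
  refine (abs_add_le _ _).trans ?_
  rw [abs_mul, abs_mul]
  nlinarith [abs_nonneg (pderiv2 f 0 x), abs_nonneg (pderiv2 f 1 x)]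

/-- Ladyzhenskaya's inequality. -/
lemma lady {g : (Fin 2 → ℝ) → ℝ} (hg : ContDiff ℝ 1 g) (hg' : HasCompactSupport g) :
    ∫ x, g x ^ 4 ≤ 8 * (∫ x, g x ^ 2) * (∫ x, ∑ j, pderiv2 g j x ^ 2) := by
  have hgc := hg.continuous
  have hd0 := pd_cont hg 0
  have hd1 := pd_cont hg 1
  have hs0 := pd_supp hg' 0
  have hs1 := pd_supp hg' 1
  have hF : ContDiff ℝ 1 (fun x => g x ^ 2) := by fun_prop
  have hF' : HasCompactSupport (fun x => g x ^ 2) := by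
    exact supp_sq hg'
  have hp : Real.HolderConjugate (Fintype.card (Fin 2) : ℝ) 2 := by
    rw [Real.holderConjugate_iff]; norm_num
  have h := lintegral_pow_le_pow_lintegral_fderiv_aux hp hF hF'
  have iF : Integrable (fun x => fderiv ℝ (fun x => g x ^ 2) x) :=
    (hF.continuous_fderiv one_ne_zero).integrable_of_hasCompactSupport (hF'.fderiv ℝ)
  have iG : Integrable (fun x => g x ^ 4) := by
    refine Continuous.integrable_of_hasCompactSupport (by fun_prop) ?_
    have e : (fun x => g x ^ 4) = fun x => (g x ^ 2) ^ 2 := by ext x; ring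
    rw [e]
    exact supp_sq hF'
  have h1 : ∫ x, g x ^ 4 ≤ (∫ x, ‖fderiv ℝ (fun x => g x ^ 2) x‖) ^ 2 := by
    have e1 : ∫⁻ x, ‖(fun x => g x ^ 2) x‖ₑ ^ (2 : ℝ) = ENNReal.ofReal (∫ x, g x ^ 4) := by
      rw [ofReal_integral_eq_lintegral_ofReal iG (Filter.Eventually.of_forall
        (fun x => by show (0 : ℝ) ≤ g x ^ 4; positivity))]
      refine lintegral_congr (fun x => ?_)
      rw [Real.enorm_eq_ofReal (by positivity), ENNReal.rpow_ofNat,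
        ← ENNReal.ofReal_pow (by positivity)]
      ring_nf
    rw [e1, ← ofReal_integral_norm_eq_lintegral_enorm iF, ENNReal.rpow_ofNat,
      ← ENNReal.ofReal_pow (integral_nonneg (fun x => norm_nonneg _))] at h
    exact (ENNReal.ofReal_le_ofReal_iff (by positivity)).1 h
  let D : (Fin 2 → ℝ) → ℝ := fun x => |pderiv2 g 0 x| + |pderiv2 g 1 x|
  have hD : Continuous D := by fun_prop
  have hD' : HasCompactSupport D := hs0.abs.add hs1.abs
  have iD : Integrable (fun x => D x ^ 2) := by
    refine Continuous.integrable_of_hasCompactSupport (by fun_prop) ?_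
    exact supp_sq hD'
  have hpt : ∀ x, ‖fderiv ℝ (fun x => g x ^ 2) x‖ ≤ 2 * (|g x| * D x) := by
    intro x
    rw [fderiv_fun_pow 2 (hg.differentiable one_ne_zero x), norm_smul]
    have := norm_fderiv_le g x
    simp only [Nat.add_one_sub_one, pow_one, nsmul_eq_mul, Nat.cast_ofNat, norm_mul,
      Real.norm_eq_abs, Nat.abs_ofNat]
    rw [mul_assoc]
    gcongr
  have h2 : ∫ x, ‖fderiv ℝ (fun x => g x ^ 2) x‖ ≤ 2 * ∫ x, |g x| * D x := by
    rw [← integral_const_mul]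
    refine integral_mono iF.norm ?_ hpt
    have hc : Continuous (fun x => |g x| * D x) := by fun_prop
    exact (hc.integrable_of_hasCompactSupport hg'.abs.mul_right).const_mul _
  have h3 := cs_int (continuous_abs.comp hgc) hg'.abs hD hD'
  have h4 : ∫ x, D x ^ 2 ≤ 2 * ∫ x, ∑ j, pderiv2 g j x ^ 2 := by
    rw [← integral_const_mul]
    refine integral_mono iD (Integrable.const_mul ?_ _) (fun x => ?_)
    · refine integrable_finsetSum _ (fun i _ => ?_)
      have := pd_cont hg i
      refine Continuous.integrable_of_hasCompactSupport (by fun_prop) ?_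
      exact supp_sq (pd_supp hg' i)
    · simp only [Fin.sum_univ_two, D]
      nlinarith [sq_nonneg (|pderiv2 g 0 x| - |pderiv2 g 1 x|), sq_abs (pderiv2 g 0 x),
        sq_abs (pderiv2 g 1 x)]
  have h0 : 0 ≤ ∫ x, ‖fderiv ℝ (fun x => g x ^ 2) x‖ := integral_nonneg (fun x => norm_nonneg _)
  simp only [Function.comp_apply, sq_abs] at h3
  have hn : 0 ≤ ∫ x, g x ^ 2 := integral_nonneg (fun x => sq_nonneg _)
  calc ∫ x, g x ^ 4 ≤ (∫ x, ‖fderiv ℝ (fun x => g x ^ 2) x‖) ^ 2 := h1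
    _ ≤ (2 * ∫ x, |g x| * D x) ^ 2 := by gcongr
    _ = 4 * (∫ x, |g x| * D x) ^ 2 := by ring
    _ ≤ 4 * ((∫ x, g x ^ 2) * (∫ x, D x ^ 2)) := by gcongr
    _ ≤ 4 * ((∫ x, g x ^ 2) * (2 * ∫ x, ∑ j, pderiv2 g j x ^ 2)) := by gcongr
    _ = _ := by ring

lemma int_sq {f : (Fin 2 → ℝ) → ℝ} (hf : Continuous f) (hf' : HasCompactSupport f) :
    Integrable (fun x => f x ^ 2) := by
  refine Continuous.integrable_of_hasCompactSupport (by fun_prop) ?_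
  exact supp_sq hf'

lemma lady_vec {w : Fin 2 → (Fin 2 → ℝ) → ℝ} (hw : ∀ i, ContDiff ℝ 1 (w i))
    (hw' : ∀ i, HasCompactSupport (w i)) :
    ∫ x, (∑ i, w i x ^ 2) ^ 2 ≤
      32 * (∫ x, ∑ i, w i x ^ 2) * (∫ x, ∑ i, ∑ j, pderiv2 (w i) j x ^ 2) := by
  have hc := fun i => (hw i).continuous
  have i2 : ∀ i, Integrable (fun x => w i x ^ 2) := fun i => int_sq (hc i) (hw' i)
  have s2 : ∀ i, HasCompactSupport (fun x => w i x ^ 2) := fun i => by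
    exact supp_sq (hw' i)
  have i4 : ∀ i, Integrable (fun x => w i x ^ 4) := fun i => by
    have hci := hc i
    have := int_sq (f := fun x => w i x ^ 2) (by fun_prop) (s2 i)
    have e : (fun x => w i x ^ 4) = fun x => (w i x ^ 2) ^ 2 := by ext x; ring
    rw [e]
    exact this
  have id : ∀ i j, Integrable (fun x => pderiv2 (w i) j x ^ 2) := fun i j =>
    int_sq (pd_cont (hw i) j) (pd_supp (hw' i) j)
  have hsum : ∫ x, (∑ i, w i x ^ 2) ^ 2 ≤ 2 * ∑ i, ∫ x, w i x ^ 4 := by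
    rw [← integral_finsetSum _ (fun i _ => i4 i), ← integral_const_mul]
    refine integral_mono ?_ ((integrable_finsetSum _ (fun i _ => i4 i)).const_mul _) (fun x => ?_)
    · refine int_sq (by fun_prop) ?_
      simp only [Fin.sum_univ_two]
      exact (s2 0).add (s2 1)
    · simp only [Fin.sum_univ_two]
      nlinarith [sq_nonneg (w 0 x ^ 2 - w 1 x ^ 2)]
  have hb : ∀ i, ∫ x, w i x ^ 4 ≤
      8 * (∫ x, ∑ i, w i x ^ 2) * (∫ x, ∑ i, ∑ j, pderiv2 (w i) j x ^ 2) := by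
    intro i
    refine (lady (hw i) (hw' i)).trans ?_
    have a1 : ∫ x, w i x ^ 2 ≤ ∫ x, ∑ i, w i x ^ 2 := by
      refine integral_mono (i2 i) (integrable_finsetSum _ (fun i _ => i2 i)) (fun x => ?_)
      exact Finset.single_le_sum (f := fun i => w i x ^ 2) (fun i _ => sq_nonneg _)
        (Finset.mem_univ i)
    have a2 : ∫ x, ∑ j, pderiv2 (w i) j x ^ 2 ≤ ∫ x, ∑ i, ∑ j, pderiv2 (w i) j x ^ 2 := by
      refine integral_mono (integrable_finsetSum _ (fun j _ => id i j))
        (integrable_finsetSum _ (fun i _ => integrable_finsetSum _ (fun j _ => id i j)))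
        (fun x => ?_)
      exact Finset.single_le_sum (f := fun i => ∑ j, pderiv2 (w i) j x ^ 2)
        (fun i _ => Finset.sum_nonneg (fun j _ => sq_nonneg _)) (Finset.mem_univ i)
    have p1 : 0 ≤ ∫ x, w i x ^ 2 := integral_nonneg (fun x => sq_nonneg _)
    have p2 : 0 ≤ ∫ x, ∑ j, pderiv2 (w i) j x ^ 2 :=
      integral_nonneg (fun x => Finset.sum_nonneg (fun j _ => sq_nonneg _))
    gcongr
  refine hsum.trans ?_
  have h0 := hb 0
  have h1 := hb 1
  rw [Fin.sum_univ_two]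
  linarith

open scoped Convolution

lemma conv_comm (f g : (Fin 2 → ℝ) → ℝ) :
    (f ⋆[ContinuousLinearMap.mul ℝ ℝ, volume] g) =
      (g ⋆[ContinuousLinearMap.mul ℝ ℝ, volume] f) := by
  rw [← convolution_flip]
  congr 1
  ext
  simp

lemma pd_conv {f g : (Fin 2 → ℝ) → ℝ} (hf : Continuous f)
    (hg : ContDiff ℝ 1 g) (hg' : HasCompactSupport g) (i : Fin 2) :
    pderiv2 (f ⋆[ContinuousLinearMap.mul ℝ ℝ, volume] g) i =
      (f ⋆[ContinuousLinearMap.mul ℝ ℝ, volume] (pderiv2 g i)) := by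
  ext x
  have h := hg'.hasFDerivAt_convolution_right (ContinuousLinearMap.mul ℝ ℝ)
    (hf.locallyIntegrable (μ := volume)) hg x
  unfold pderiv2
  rw [h.fderiv, convolution_precompR_apply _ hf.locallyIntegrable (hg'.fderiv ℝ)
    (hg.continuous_fderiv one_ne_zero)]

/-- `∫ ∂ᵢf ∂ⱼg = ∫ ∂ⱼf ∂ᵢg`, for functions which are only `C¹`. -/
lemma int_swap {f g : (Fin 2 → ℝ) → ℝ} (hf : ContDiff ℝ 1 f) (hf' : HasCompactSupport f)
    (hg : ContDiff ℝ 1 g) (hg' : HasCompactSupport g) (i j : Fin 2) :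
    ∫ x, pderiv2 f i x * pderiv2 g j x = ∫ x, pderiv2 f j x * pderiv2 g i x := by
  set k : (Fin 2 → ℝ) → ℝ := fun x => g (-x) with hk
  have kc : ContDiff ℝ 1 k := by fun_prop
  have ks : HasCompactSupport k := hg'.comp_homeomorph (Homeomorph.neg _)
  have kd : ∀ i x, pderiv2 k i x = - pderiv2 g i (-x) := by
    intro i x
    have h1 : HasFDerivAt g (fderiv ℝ g (-x)) (-x) :=
      (hg.differentiable one_ne_zero (-x)).hasFDerivAt
    have h2 : HasFDerivAt k ((fderiv ℝ g (-x)).comp (-ContinuousLinearMap.id ℝ (Fin 2 → ℝ))) x :=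
      h1.comp x (hasFDerivAt_id x).neg
    unfold pderiv2
    rw [h2.fderiv]
    simp
  have e1 : pderiv2 (pderiv2 (f ⋆[ContinuousLinearMap.mul ℝ ℝ, volume] k) i) j =
      (pderiv2 f j ⋆[ContinuousLinearMap.mul ℝ ℝ, volume] (pderiv2 k i)) := by
    rw [pd_conv hf.continuous kc ks, conv_comm, pd_conv (pd_cont kc i) hf hf', conv_comm]
  have e2 : pderiv2 (pderiv2 (f ⋆[ContinuousLinearMap.mul ℝ ℝ, volume] k) i) j =
      (pderiv2 f i ⋆[ContinuousLinearMap.mul ℝ ℝ, volume] (pderiv2 k j)) := by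
    rw [conv_comm, pd_conv kc.continuous hf hf', conv_comm, pd_conv (pd_cont hf i) kc ks]
  have e := congrFun (e1.symm.trans e2) 0
  simp only [convolution_def, kd, ContinuousLinearMap.mul_apply', zero_sub, neg_neg, mul_neg,
    integral_neg, neg_inj] at e
  exact e.symm

lemma pd_symm {C : (Fin 2 → ℝ) → ℝ} (hC : ContDiff ℝ 2 C) (i j : Fin 2) (x : Fin 2 → ℝ) :
    pderiv2 (pderiv2 C i) j x = pderiv2 (pderiv2 C j) i x := by
  have hs : IsSymmSndFDerivAt ℝ C x := hC.contDiffAt.isSymmSndFDerivAt (by simp)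
  have hd : DifferentiableAt ℝ (fderiv ℝ C) x :=
    ((hC.fderiv_right (m := 1) (by norm_num)).differentiable one_ne_zero) x
  have e : ∀ i j, pderiv2 (pderiv2 C i) j x =
      fderiv ℝ (fderiv ℝ C) x (Pi.single j 1) (Pi.single i 1) := by
    intro i j
    unfold pderiv2
    have h := hd.hasFDerivAt.clm_apply
      (hasFDerivAt_const (Pi.single i (1 : ℝ) : Fin 2 → ℝ) x)
    rw [h.fderiv]
    simp
  rw [e, e]
  exact hs _ _

lemma hess_eq_lap {C : (Fin 2 → ℝ) → ℝ} (hC : ContDiff ℝ 2 C) (hC' : HasCompactSupport C) :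
    ∫ x, ∑ i, ∑ j, pderiv2 (pderiv2 C i) j x ^ 2 = ∫ x, lap2 C x ^ 2 := by
  have c1 := fun i => pd_contDiff hC i
  have s1 := fun i => pd_supp hC' i
  have c2 := fun i j => pd_cont (c1 i) j
  have s2 := fun i j => pd_supp (s1 i) j
  have i2 : ∀ i j k l, Integrable
      (fun x => pderiv2 (pderiv2 C i) j x * pderiv2 (pderiv2 C k) l x) := fun i j k l => by
    have := c2 i j
    have := c2 k l
    exact Continuous.integrable_of_hasCompactSupport (by fun_prop) (s2 i j).mul_right
  have hsw := int_swap (c1 0) (s1 0) (c1 1) (s1 1) 0 1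
  have l : ∫ x, ∑ i, ∑ j, pderiv2 (pderiv2 C i) j x ^ 2 =
      (∫ x, pderiv2 (pderiv2 C 0) 0 x * pderiv2 (pderiv2 C 0) 0 x) +
      (∫ x, pderiv2 (pderiv2 C 1) 1 x * pderiv2 (pderiv2 C 1) 1 x) +
      2 * ∫ x, pderiv2 (pderiv2 C 0) 1 x * pderiv2 (pderiv2 C 1) 0 x := by
    rw [← integral_const_mul,
      ← int_add3 (i2 _ _ _ _) (i2 _ _ _ _) ((i2 _ _ _ _).const_mul _)]
    congr 1
    ext x
    simp only [Fin.sum_univ_two, pd_symm hC 1 0 x]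
    ring
  have r : ∫ x, lap2 C x ^ 2 =
      (∫ x, pderiv2 (pderiv2 C 0) 0 x * pderiv2 (pderiv2 C 0) 0 x) +
      (∫ x, pderiv2 (pderiv2 C 1) 1 x * pderiv2 (pderiv2 C 1) 1 x) +
      2 * ∫ x, pderiv2 (pderiv2 C 0) 0 x * pderiv2 (pderiv2 C 1) 1 x := by
    rw [← integral_const_mul,
      ← int_add3 (i2 _ _ _ _) (i2 _ _ _ _) ((i2 _ _ _ _).const_mul _)]
    congr 1
    ext x
    simp only [Fin.sum_univ_two, lap2]
    ring
  rw [l, r, hsw]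

/-- Estimate (26) of the paper:
`|∫ (u·∇C) ΔC| ≤ ε ‖ΔC‖² + M ‖∇C‖² ‖u‖² ‖∇u‖²`. -/
theorem estimate_convection_against_laplacian :
    ∀ ε : ℝ, 0 < ε → ∃ M : ℝ, 0 < M ∧
      ∀ (u : (Fin 2 → ℝ) → (Fin 2 → ℝ)) (C : (Fin 2 → ℝ) → ℝ),
        ContDiff ℝ 1 u → HasCompactSupport u →
        ContDiff ℝ 2 C → HasCompactSupport C →
        |∫ x, (∑ i, u x i * pderiv2 C i x) * lap2 C x| ≤
          ε * (∫ x, (lap2 C x) ^ 2) +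
            M * (∫ x, ∑ i, (pderiv2 C i x) ^ 2) * (∫ x, ∑ i, (u x i) ^ 2) *
              (∫ x, ∑ i, ∑ j, (pderiv2 (fun y => u y i) j x) ^ 2) := by
  intro ε hε
  refine ⟨128 / ε ^ 3, by positivity, fun u C hu hu' hC hC' => ?_⟩
  have uc : ∀ i, ContDiff ℝ 1 (fun y => u y i) := fun i => by fun_prop
  have us : ∀ i, HasCompactSupport (fun y => u y i) := fun i =>
    hu'.comp_left (g := fun v : Fin 2 → ℝ => v i) rfl
  have c1 := fun i => pd_contDiff hC i
  have s1 := fun i => pd_supp hC' i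
  have ucc : ∀ i, Continuous (fun y => u y i) := fun i => (uc i).continuous
  have c1c := fun i => (c1 i).continuous
  have lc : Continuous (lap2 C) := by
    have := fun i => pd_cont (c1 i) i
    unfold lap2
    fun_prop
  have ls : HasCompactSupport (lap2 C) := by
    have e : lap2 C = pderiv2 (pderiv2 C 0) 0 + pderiv2 (pderiv2 C 1) 1 := by
      ext x; simp [lap2]
    rw [e]
    exact (pd_supp (s1 0) 0).add (pd_supp (s1 1) 1)
  have hA : ∀ {f : (Fin 2 → ℝ) → ℝ}, HasCompactSupport f →
      HasCompactSupport (fun x => f x ^ 2) := fun {f} hf => by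
    exact supp_sq hf
  let P : (Fin 2 → ℝ) → ℝ := fun x => ∑ i, u x i ^ 2
  let Q : (Fin 2 → ℝ) → ℝ := fun x => ∑ i, pderiv2 C i x ^ 2
  let R : (Fin 2 → ℝ) → ℝ := fun x => ∑ i, u x i * pderiv2 C i x
  have Pc : Continuous P := by fun_prop
  have Qc : Continuous Q := by fun_prop
  have Rc : Continuous R := by fun_prop
  have Ps : HasCompactSupport P := by
    simp only [P, Fin.sum_univ_two]
    exact (hA (us 0)).add (hA (us 1))
  have Qs : HasCompactSupport Q := by
    simp only [Q, Fin.sum_univ_two]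
    exact (hA (s1 0)).add (hA (s1 1))
  have Rs : HasCompactSupport R := by
    simp only [R, Fin.sum_univ_two]
    exact ((us 0).mul_right (f' := pderiv2 C 0)).add ((us 1).mul_right (f' := pderiv2 C 1))
  have hP := lady_vec uc us
  have hQ := lady_vec c1 s1
  rw [hess_eq_lap hC hC'] at hQ
  have hPQ := cs_int Pc Ps Qc Qs
  have hR : ∫ x, R x ^ 2 ≤ ∫ x, P x * Q x := by
    refine integral_mono (int_sq Rc Rs)
      (Continuous.integrable_of_hasCompactSupport (by fun_prop) Ps.mul_right) (fun x => ?_)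
    simp only [P, Q, R, Fin.sum_univ_two]
    nlinarith [sq_nonneg (u x 0 * pderiv2 C 1 x - u x 1 * pderiv2 C 0 x)]
  have hI : |∫ x, R x * lap2 C x| ≤ ε / 2 * (∫ x, lap2 C x ^ 2) + 1 / (2 * ε) * ∫ x, R x ^ 2 := by
    refine (abs_integral_le_integral_abs).trans ?_
    rw [← integral_const_mul, ← integral_const_mul,
      ← integral_add ((int_sq lc ls).const_mul _) ((int_sq Rc Rs).const_mul _)]
    refine integral_mono ?_ (((int_sq lc ls).const_mul _).add ((int_sq Rc Rs).const_mul _))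
      (fun x => ?_)
    · exact (Continuous.integrable_of_hasCompactSupport (by fun_prop) Rs.mul_right).abs
    · show |R x * lap2 C x| ≤ ε / 2 * lap2 C x ^ 2 + 1 / (2 * ε) * R x ^ 2
      have e : ε / 2 * lap2 C x ^ 2 + 1 / (2 * ε) * R x ^ 2 - |R x * lap2 C x| =
          1 / (2 * ε) * (ε * |lap2 C x| - |R x|) ^ 2 := by
        rw [abs_mul, ← sq_abs (lap2 C x), ← sq_abs (R x)]
        field_simp
        ring
      have : 0 ≤ 1 / (2 * ε) * (ε * |lap2 C x| - |R x|) ^ 2 := by positivity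
      linarith
  have nU : 0 ≤ ∫ x, ∑ i, u x i ^ 2 :=
    integral_nonneg (fun x => Finset.sum_nonneg (fun j _ => sq_nonneg _))
  have nG : 0 ≤ ∫ x, ∑ i, pderiv2 C i x ^ 2 :=
    integral_nonneg (fun x => Finset.sum_nonneg (fun j _ => sq_nonneg _))
  have nV : 0 ≤ ∫ x, ∑ i, ∑ j, pderiv2 (fun y => u y i) j x ^ 2 :=
    integral_nonneg (fun x => Finset.sum_nonneg (fun i _ =>
      Finset.sum_nonneg (fun j _ => sq_nonneg _)))
  have nA : 0 ≤ ∫ x, lap2 C x ^ 2 := integral_nonneg (fun x => sq_nonneg _)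
  have nQ : 0 ≤ ∫ x, Q x ^ 2 := integral_nonneg (fun x => sq_nonneg _)
  change |∫ x, R x * lap2 C x| ≤ _
  change ∫ x, P x ^ 2 ≤ _ at hP
  change ∫ x, Q x ^ 2 ≤ _ at hQ
  generalize (∫ x, ∑ i, u x i ^ 2) = U at *
  generalize (∫ x, ∑ i, pderiv2 C i x ^ 2) = G at *
  generalize (∫ x, ∑ i, ∑ j, pderiv2 (fun y => u y i) j x ^ 2) = V at *
  generalize (∫ x, lap2 C x ^ 2) = A at *
  have h1 : (∫ x, P x * Q x) ^ 2 ≤ (32 * U * V) * (32 * G * A) :=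
    hPQ.trans (mul_le_mul hP hQ nQ (by positivity))
  have h2 : ∫ x, P x * Q x ≤ ε ^ 2 * A + 256 / ε ^ 2 * (G * U * V) := by
    refine le_of_abs_le (abs_le_of_sq_le_sq ?_ (by positivity))
    refine h1.trans ?_
    have e : (ε ^ 2 * A + 256 / ε ^ 2 * (G * U * V)) ^ 2 - 32 * U * V * (32 * G * A) =
        (ε ^ 2 * A - 256 / ε ^ 2 * (G * U * V)) ^ 2 := by
      field_simp
      ring
    nlinarith [sq_nonneg (ε ^ 2 * A - 256 / ε ^ 2 * (G * U * V))]
  refine hI.trans ?_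
  calc ε / 2 * A + 1 / (2 * ε) * ∫ x, R x ^ 2
      ≤ ε / 2 * A + 1 / (2 * ε) * (ε ^ 2 * A + 256 / ε ^ 2 * (G * U * V)) := by
        gcongr
        exact hR.trans h2
    _ = _ := by
        field_simp
        ring
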